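/- arXiv:1503.07123 — 2 statements merged into one kernel-verified Lean document; each statement's English description precedes it below -/
import Mathlib

section
/- Let Ω = {v ∈ ℝ² : W(v) ≠ 0} and f = log(Re W) on Ω. For every real a > 1/6 and every b ∈ ℝ there exist a point v ∈ Ω and a vector u ∈ ℝ² such that −Hess f(v)(u,u) < b·|u|² + a·⟨∇f(v), u⟩². (Hence for a > 1/6 the quantity inf over unit vectors of −Hess f − a ∇f ⊗ ∇f is unbounded below on Ω, so no curvature-dimension inequality with this coefficient can hold.) -/
open scoped RealInnerProductSpace
noncomputable section

/-- The plane `ℝ²`. -/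
abbrev Plane := EuclideanSpace ℝ (Fin 2)

/-- The three unit vectors `E₁ = (1,0)`, `E₂ = (−1/2, √3/2)`, `E₃ = (−1/2, −√3/2)`. -/
def E : Fin 3 → Plane := fun k =>
  (WithLp.equiv 2 (Fin 2 → ℝ)).symm
    (![![1, 0], ![-(1/2), Real.sqrt 3 / 2], ![-(1/2), -(Real.sqrt 3 / 2)]] k)

/-- `z_k(v) = exp(i⟨v, E_k⟩)`. -/
def z (k : Fin 3) (v : Plane) : ℂ := Complex.exp (Complex.I * ((⟪v, E k⟫ : ℝ) : ℂ))

/-- `W = −((z₁−z₂)(z₂−z₃)(z₃−z₁))²`. -/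
def W (v : Plane) : ℂ :=
  -((z 0 v - z 1 v) * (z 1 v - z 2 v) * (z 2 v - z 0 v)) ^ 2

/-- The open set `Ω = {W ≠ 0}`. -/
def Omega : Set Plane := {v | W v ≠ 0}

/-- `f = log (Re W)`. -/
def fdel (v : Plane) : ℝ := Real.log (W v).re

/-- The Hessian (second Fréchet derivative) of a scalar function, as a bilinear form. -/
def Hess (g : Plane → ℝ) (v u w : Plane) : ℝ := fderiv ℝ (fderiv ℝ g) v u w

open Filter Topology

theorem contDiff_z (k : Fin 3) : ContDiff ℝ 2 (z k) := by
  unfold z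
  have h : ContDiff ℝ 2 fun v : Plane => ((⟪v, E k⟫ : ℝ) : ℂ) :=
    Complex.ofRealCLM.contDiff.comp (contDiff_id.inner ℝ contDiff_const)
  exact (contDiff_const.mul h).cexp

theorem contDiff_W_re : ContDiff ℝ 2 fun v => (W v).re := by
  refine Complex.reCLM.contDiff.comp (?_ : ContDiff ℝ 2 W)
  unfold W
  exact (((((contDiff_z 0).sub (contDiff_z 1)).mul ((contDiff_z 1).sub (contDiff_z 2))).mul
    ((contDiff_z 2).sub (contDiff_z 0))).pow 2).neg

/-- The vector spanning the symmetry axis `⟨v, E₁⟩ = 0`, scaled so that `⟨v, E₂⟩ = 1`. -/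
def axisVec : Plane := !₂[0, 2 / Real.sqrt 3]

theorem norm_sq_axisVec : ‖axisVec‖ ^ 2 = 4 / 3 := by
  simp [axisVec, EuclideanSpace.norm_sq_eq, Fin.sum_univ_two, div_pow]
  norm_num

theorem W_smul_axisVec (x : ℝ) :
    W (x • axisVec) = ((16 * Real.sin x ^ 2 * (1 - Real.cos x) ^ 2 : ℝ) : ℂ) := by
  have h3 : Real.sqrt 3 ≠ 0 := by positivity
  have h0 : (⟪x • axisVec, E 0⟫ : ℝ) = 0 := by
    simp [axisVec, E, PiLp.inner_apply, Fin.sum_univ_two]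
  have h1 : (⟪x • axisVec, E 1⟫ : ℝ) = x := by
    simp [axisVec, E, PiLp.inner_apply, Fin.sum_univ_two]
    field_simp
  have h2 : (⟪x • axisVec, E 2⟫ : ℝ) = -x := by
    simp [axisVec, E, PiLp.inner_apply, Fin.sum_univ_two]
    field_simp
  have e1 : Complex.exp (Complex.I * (x : ℂ)) = Complex.cos x + Complex.sin x * Complex.I := by
    rw [mul_comm, Complex.exp_mul_I]
  have e2 : Complex.exp (Complex.I * ((-x : ℝ) : ℂ)) =
      Complex.cos x - Complex.sin x * Complex.I := by
    rw [mul_comm, Complex.exp_mul_I]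
    simp [sub_eq_add_neg]
  have hI := Complex.I_sq
  have hsc := Complex.sin_sq_add_cos_sq (x : ℂ)
  unfold W z
  rw [h0, h1, h2, e1, e2]
  simp only [Complex.ofReal_zero, mul_zero, Complex.exp_zero]
  push_cast
  generalize Complex.cos (x : ℂ) = c at *
  generalize Complex.sin (x : ℂ) = s at *
  have hp : (1 - (c + s * Complex.I)) * (c + s * Complex.I - (c - s * Complex.I)) *
      (c - s * Complex.I - 1) = -4 * s * (1 - c) * Complex.I := by
    linear_combination (2 * s ^ 3 * Complex.I) * hI + (-2 * s * Complex.I) * hsc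
  rw [hp]
  linear_combination (-16 * s ^ 2 * (1 - c) ^ 2) * hI

theorem one_sub_cos_ne_zero {x : ℝ} (hx : Real.sin x ≠ 0) : 1 - Real.cos x ≠ 0 := by
  intro h
  apply hx
  have := Real.sin_sq_add_cos_sq x
  rw [← sub_eq_zero.1 h] at this
  simpa using this

theorem W_re_smul_axisVec_ne_zero {x : ℝ} (hx : Real.sin x ≠ 0) :
    (W (x • axisVec)).re ≠ 0 := by
  rw [W_smul_axisVec, Complex.ofReal_re]
  have := one_sub_cos_ne_zero hx
  positivity

theorem contDiffAt_fdel {v : Plane} (hv : (W v).re ≠ 0) : ContDiffAt ℝ 2 fdel v :=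
  contDiff_W_re.contDiffAt.log hv

theorem hasDerivAt_smul_line (u : Plane) (x : ℝ) : HasDerivAt (fun t : ℝ => t • u) u x := by
  simpa using (hasDerivAt_id x).smul_const u

theorem fderiv_fdel_axisVec {x : ℝ} (hx : Real.sin x ≠ 0) :
    fderiv ℝ fdel (x • axisVec) axisVec = (2 + 4 * Real.cos x) / Real.sin x := by
  have h1 := ((contDiffAt_fdel (W_re_smul_axisVec_ne_zero hx)).differentiableAt
    (by norm_num)).hasFDerivAt.comp_hasDerivAt x (hasDerivAt_smul_line axisVec x)
  have hc := one_sub_cos_ne_zero hx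
  have h2 := ((((Real.hasDerivAt_sin x).pow 2).const_mul 16).mul
    (((Real.hasDerivAt_cos x).const_sub 1).pow 2)).log (by simp; tauto)
  have h3 : fdel ∘ (fun t : ℝ => t • axisVec) =
      fun t => Real.log (16 * Real.sin t ^ 2 * (1 - Real.cos t) ^ 2) := by
    funext t
    simp only [Function.comp_apply, fdel, W_smul_axisVec, Complex.ofReal_re]
  rw [h3] at h1
  rw [h1.unique h2]
  have hsc := Real.sin_sq_add_cos_sq x
  simp
  field_simp
  linear_combination 2 * hsc

theorem hasDerivAt_fderiv_line {g : Plane → ℝ} {u : Plane} {x : ℝ}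
    (hd : DifferentiableAt ℝ (fderiv ℝ g) (x • u)) :
    HasDerivAt (fun t : ℝ => fderiv ℝ g (t • u) u) (Hess g (x • u) u u) x := by
  have h : HasDerivAt (fun t : ℝ => fderiv ℝ g (t • u)) (fderiv ℝ (fderiv ℝ g) (x • u) u) x :=
    hd.hasFDerivAt.comp_hasDerivAt x (hasDerivAt_smul_line u x)
  simpa [Hess] using h.clm_apply (hasDerivAt_const x u)

theorem Hess_fdel_axisVec {x : ℝ} (hx : Real.sin x ≠ 0) :
    Hess fdel (x • axisVec) axisVec axisVec = -(4 + 2 * Real.cos x) / Real.sin x ^ 2 := by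
  have hd : DifferentiableAt ℝ (fderiv ℝ fdel) (x • axisVec) :=
    ((contDiffAt_fdel (W_re_smul_axisVec_ne_zero hx)).fderiv_right (m := 1)
      (by norm_num)).differentiableAt (by norm_num)
  have h2 : HasDerivAt (fun t => (2 + 4 * Real.cos t) / Real.sin t)
      ((4 * -Real.sin x * Real.sin x - (2 + 4 * Real.cos x) * Real.cos x) / Real.sin x ^ 2) x :=
    (((Real.hasDerivAt_cos x).const_mul 4).const_add 2).div (Real.hasDerivAt_sin x) hx
  have h3 : (fun t : ℝ => fderiv ℝ fdel (t • axisVec) axisVec) =ᶠ[𝓝 x]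
      fun t => (2 + 4 * Real.cos t) / Real.sin t := by
    filter_upwards [Real.continuous_sin.continuousAt.eventually_ne hx] with t ht
    exact fderiv_fdel_axisVec ht
  rw [(hasDerivAt_fderiv_line hd).unique (h2.congr_of_eventuallyEq h3)]
  congr 1
  linear_combination (-4) * Real.sin_sq_add_cos_sq x

/-- For any `a > 1/6` and any `b`, the inequality
`−Hess f ≥ b·Id + a·∇f ⊗ ∇f` fails somewhere on `Ω`. -/
theorem deltoid_no_CD_above_one_sixth :
    ∀ a : ℝ, 1/6 < a → ∀ b : ℝ, ∃ v ∈ Omega, ∃ u : Plane,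
      -Hess fdel v u u < b * ‖u‖ ^ 2 + a * ⟪gradient fdel v, u⟫ ^ 2 := by
  intro a ha b
  have hev : ∀ᶠ x in 𝓝 (0 : ℝ), 4 + 2 * Real.cos x <
      b * (4 / 3) * Real.sin x ^ 2 + a * (2 + 4 * Real.cos x) ^ 2 := by
    refine ContinuousAt.eventually_lt (by fun_prop) (by fun_prop) ?_
    simp
    linarith
  have hpos : ∀ᶠ x in 𝓝[>] (0 : ℝ), 0 < Real.sin x := by
    filter_upwards [Ioo_mem_nhdsGT Real.pi_pos] with x hx
    exact Real.sin_pos_of_mem_Ioo hx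
  obtain ⟨x, hx, hs⟩ := ((hev.filter_mono nhdsWithin_le_nhds).and hpos).exists
  refine ⟨x • axisVec, fun h => W_re_smul_axisVec_ne_zero hs.ne' (by rw [h]; rfl), axisVec, ?_⟩
  have hg : (⟪gradient fdel (x • axisVec), axisVec⟫ : ℝ) =
      fderiv ℝ fdel (x • axisVec) axisVec := by
    simp [gradient]
  rw [hg, fderiv_fdel_axisVec hs.ne', Hess_fdel_axisVec hs.ne', norm_sq_axisVec, neg_div, neg_neg,
    div_lt_iff₀ (by positivity)]
  have hne := hs.ne'
  have heq : (b * (4 / 3) + a * ((2 + 4 * Real.cos x) / Real.sin x) ^ 2) * Real.sin x ^ 2 =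
      b * (4 / 3) * Real.sin x ^ 2 + a * (2 + 4 * Real.cos x) ^ 2 := by
    field_simp
  rw [heq]
  exact hx
end
end

section
/- Let Ω = {v ∈ ℝ² : W(v) ≠ 0} and f = log(Re W) on Ω. Then Hess f is not bounded below on Ω: for every M ∈ ℝ there exist a point v ∈ Ω and a unit vector u ∈ ℝ² such that Hess f(v)(u,u) < −M. (Consequently, for 0 < λ < 1 the deltoid operator ℒ^{(λ)} = Δ + ((λ−1)/3)∇f·∇ satisfies no curvature-dimension inequality CD(ρ, ∞) for any ρ ∈ ℝ.) -/
open scoped RealInnerProductSpace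
noncomputable section

/-- The linear forms `v ↦ ⟨v, E_k − E_{k+1}⟩ / 2`. -/
def halfRoot (k : Fin 3) : Plane →L[ℝ] ℝ := (1 / 2 : ℝ) • innerSL ℝ (E k - E (k + 1))

lemma halfRoot_apply (k : Fin 3) (v : Plane) :
    halfRoot k v = (⟪v, E k⟫ - ⟪v, E (k + 1)⟫) / 2 := by
  simp [halfRoot, real_inner_comm]
  ring

lemma exp_I_sub_exp_I (a b : ℝ) :
    Complex.exp (Complex.I * a) - Complex.exp (Complex.I * b) =
      Complex.exp (Complex.I * ((a + b) / 2 : ℝ)) *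
        (2 * Complex.I * (Real.sin ((a - b) / 2) : ℝ)) := by
  have ha : Complex.I * a = Complex.I * ((a + b) / 2 : ℝ) + ((a - b) / 2 : ℝ) * Complex.I := by
    push_cast; ring
  have hb : Complex.I * b = Complex.I * ((a + b) / 2 : ℝ) + (-((a - b) / 2) : ℝ) * Complex.I := by
    push_cast; ring
  rw [ha, hb, Complex.exp_add, Complex.exp_add, Complex.exp_mul_I, Complex.exp_mul_I,
    ← Complex.ofReal_cos, ← Complex.ofReal_sin, ← Complex.ofReal_cos, ← Complex.ofReal_sin,
    Real.cos_neg, Real.sin_neg]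
  push_cast
  ring

lemma sum_inner_E (v : Plane) : ⟪v, E 0⟫ + ⟪v, E 1⟫ + ⟪v, E 2⟫ = 0 := by
  simp [E, PiLp.inner_apply, Fin.sum_univ_two]
  ring

lemma W_eq (v : Plane) : W v = ((64 * (∏ k, Real.sin (halfRoot k v)) ^ 2 : ℝ) : ℂ) := by
  have hexp : Complex.exp (Complex.I * ((⟪v, E 0⟫ + ⟪v, E 1⟫) / 2 : ℝ)) *
      Complex.exp (Complex.I * ((⟪v, E 1⟫ + ⟪v, E 2⟫) / 2 : ℝ)) *
      Complex.exp (Complex.I * ((⟪v, E 2⟫ + ⟪v, E 0⟫) / 2 : ℝ)) = 1 := by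
    rw [← Complex.exp_add, ← Complex.exp_add, ← mul_add, ← mul_add, ← Complex.ofReal_add,
      ← Complex.ofReal_add, show (⟪v, E 0⟫ + ⟪v, E 1⟫) / 2 + (⟪v, E 1⟫ + ⟪v, E 2⟫) / 2 +
        (⟪v, E 2⟫ + ⟪v, E 0⟫) / 2 = 0 by linarith [sum_inner_E v]]
    simp
  simp only [W, z, exp_I_sub_exp_I, Fin.prod_univ_three, halfRoot_apply]
  rw [show (0 : Fin 3) + 1 = 1 from rfl, show (1 : Fin 3) + 1 = 2 from rfl,
    show (2 : Fin 3) + 1 = 0 from rfl]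
  generalize Complex.exp (Complex.I * ((⟪v, E 0⟫ + ⟪v, E 1⟫) / 2 : ℝ)) = p at *
  generalize Complex.exp (Complex.I * ((⟪v, E 1⟫ + ⟪v, E 2⟫) / 2 : ℝ)) = q at *
  generalize Complex.exp (Complex.I * ((⟪v, E 2⟫ + ⟪v, E 0⟫) / 2 : ℝ)) = r at *
  generalize Real.sin ((⟪v, E 0⟫ - ⟪v, E 1⟫) / 2) = a
  generalize Real.sin ((⟪v, E 1⟫ - ⟪v, E 2⟫) / 2) = b
  generalize Real.sin ((⟪v, E 2⟫ - ⟪v, E 0⟫) / 2) = c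
  push_cast
  calc _ = -((p * q * r) ^ 2 * (Complex.I ^ 2) ^ 3 * (64 * (a * b * c : ℂ) ^ 2)) := by ring
    _ = _ := by rw [hexp, Complex.I_sq]; ring

lemma mem_Omega_iff {v : Plane} : v ∈ Omega ↔ ∀ k, Real.sin (halfRoot k v) ≠ 0 := by
  simp only [Omega, Set.mem_ofPred_eq, W_eq]
  rw [Complex.ofReal_ne_zero]
  simp [Finset.prod_eq_zero_iff]

lemma isOpen_Omega : IsOpen Omega := by
  have h : Omega = ⋂ k, {v | Real.sin (halfRoot k v) ≠ 0} := by
    ext v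
    simp [mem_Omega_iff]
  rw [h]
  exact isOpen_iInter_of_finite fun k => isOpen_ne_fun (by fun_prop) continuous_const

lemma fdel_eq {v : Plane} (hv : v ∈ Omega) :
    fdel v = Real.log 64 + ∑ k, 2 * Real.log (Real.sin (halfRoot k v)) := by
  rw [mem_Omega_iff] at hv
  rw [fdel, W_eq, Complex.ofReal_re,
    Real.log_mul (by norm_num) (pow_ne_zero _ (Finset.prod_ne_zero_iff.2 fun k _ => hv k)),
    Real.log_pow, Real.log_prod fun k _ => hv k, ← Finset.mul_sum]
  norm_num

lemma hasFDerivAt_fdel {v : Plane} (hv : v ∈ Omega) :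
    HasFDerivAt fdel
      (∑ k, (2 * (Real.cos (halfRoot k v) / Real.sin (halfRoot k v))) • halfRoot k) v := by
  have h : HasFDerivAt
      (fun w => Real.log 64 + ∑ k, 2 * Real.log (Real.sin (halfRoot k w)))
      (∑ k, (2 * (Real.cos (halfRoot k v) / Real.sin (halfRoot k v))) • halfRoot k) v := by
    refine (HasFDerivAt.fun_sum fun k _ => ?_).const_add _
    exact (((Real.hasDerivAt_sin _).log (mem_Omega_iff.1 hv k)).const_mul 2).comp_hasFDerivAt v
      (halfRoot k).hasFDerivAt
  refine h.congr_of_eventuallyEq ?_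
  filter_upwards [isOpen_Omega.mem_nhds hv] with w hw using fdel_eq hw

lemma Hess_fdel {v : Plane} (hv : v ∈ Omega) (u w : Plane) :
    Hess fdel v u w =
      -∑ k, 2 * (halfRoot k u * halfRoot k w) / Real.sin (halfRoot k v) ^ 2 := by
  have h : HasFDerivAt
      (fun x => ∑ k, (2 * (Real.cos (halfRoot k x) / Real.sin (halfRoot k x))) • halfRoot k)
      (∑ k, ((-2 / Real.sin (halfRoot k v) ^ 2) • halfRoot k).smulRight (halfRoot k)) v := by
    refine HasFDerivAt.fun_sum fun k _ => ?_
    have hs := mem_Omega_iff.1 hv k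
    have hcot : HasDerivAt (fun t => 2 * (Real.cos t / Real.sin t))
        (-2 / Real.sin (halfRoot k v) ^ 2) (halfRoot k v) := by
      refine (((Real.hasDerivAt_cos _).div (Real.hasDerivAt_sin _) hs).const_mul 2).congr_deriv ?_
      rw [show (-2 : ℝ) = 2 * -1 by norm_num, mul_div_assoc]
      congr 2
      linarith [Real.sin_sq_add_cos_sq (halfRoot k v)]
    have hcomp : HasFDerivAt
        (fun x => 2 * (Real.cos (halfRoot k x) / Real.sin (halfRoot k x)))
        ((-2 / Real.sin (halfRoot k v) ^ 2) • halfRoot k) v :=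
      hcot.comp_hasFDerivAt v (halfRoot k).hasFDerivAt
    exact hcomp.smul_const (halfRoot k)
  have heq : fderiv ℝ fdel =ᶠ[nhds v]
      fun x => ∑ k, (2 * (Real.cos (halfRoot k x) / Real.sin (halfRoot k x))) • halfRoot k := by
    filter_upwards [isOpen_Omega.mem_nhds hv] with x hx using (hasFDerivAt_fdel hx).fderiv
  rw [Hess, (h.congr_of_eventuallyEq heq).fderiv, ← Finset.sum_neg_distrib]
  simp only [sum_apply, ContinuousLinearMap.smulRight_apply,
    smul_apply, smul_eq_mul]
  exact Finset.sum_congr rfl fun k _ => by ring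

lemma halfRoot_zero_mk (x y : ℝ) : halfRoot 0 !₂[x, y] = 3 / 4 * x - √3 / 4 * y := by
  simp [halfRoot_apply, E, PiLp.inner_apply, Fin.sum_univ_two]
  ring

lemma halfRoot_one_mk (x y : ℝ) : halfRoot 1 !₂[x, y] = √3 / 2 * y := by
  simp [halfRoot_apply, E, PiLp.inner_apply, Fin.sum_univ_two]

lemma halfRoot_two_mk (x y : ℝ) : halfRoot 2 !₂[x, y] = -(3 / 4 * x) - √3 / 4 * y := by
  simp [halfRoot_apply, E, PiLp.inner_apply, Fin.sum_univ_two]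
  ring

/-- The Hessian of `f = log (Re W)` is not bounded below on `Ω`. -/
theorem deltoid_hess_unbounded_below :
    ∀ M : ℝ, ∃ v ∈ Omega, ∃ u : Plane, ‖u‖ = 1 ∧ Hess fdel v u u < -M := by
  intro M
  set s : ℝ := (|M| + 1)⁻¹ with hs
  have hs0 : 0 < s := by positivity
  have hs1 : s ≤ 1 := inv_le_one_of_one_le₀ (by linarith [abs_nonneg M])
  have h3 : √3 * √3 = 3 := Real.mul_self_sqrt (by norm_num)
  set v : Plane := !₂[2 * Real.pi / 3, 2 * s / √3] with hv
  have h0 : halfRoot 0 v = Real.pi / 2 - s / 2 := by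
    rw [hv, halfRoot_zero_mk]; field_simp; ring
  have h1 : halfRoot 1 v = s := by
    rw [hv, halfRoot_one_mk]; field_simp
  have h2 : halfRoot 2 v = -(s / 2 + Real.pi / 2) := by
    rw [hv, halfRoot_two_mk]; field_simp; ring
  have hsin : 0 < Real.sin s :=
    Real.sin_pos_of_pos_of_lt_pi hs0 (by linarith [Real.pi_gt_three])
  have hcos : 0 < Real.cos (s / 2) :=
    Real.cos_pos_of_mem_Ioo ⟨by linarith [Real.pi_gt_three], by linarith [Real.pi_gt_three]⟩
  have hvΩ : v ∈ Omega := by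
    rw [mem_Omega_iff, Fin.forall_fin_succ, Fin.forall_fin_two]
    refine ⟨?_, ?_, ?_⟩
    · rw [h0, Real.sin_pi_div_two_sub]; exact hcos.ne'
    · exact (congrArg Real.sin h1).trans_ne hsin.ne'
    · refine (congrArg Real.sin h2).trans_ne ?_
      rw [Real.sin_neg, Real.sin_add_pi_div_two]
      exact neg_ne_zero.2 hcos.ne'
  refine ⟨v, hvΩ, !₂[0, 1], by simp [EuclideanSpace.norm_eq], ?_⟩
  rw [Hess_fdel hvΩ, neg_lt_neg_iff]
  have hterm : M < 2 * (halfRoot 1 !₂[0, 1] * halfRoot 1 !₂[0, 1]) /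
      Real.sin (halfRoot 1 v) ^ 2 := by
    rw [h1, halfRoot_one_mk, show 2 * (√3 / 2 * 1 * (√3 / 2 * 1)) = (3 / 2 : ℝ) by linarith,
      lt_div_iff₀ (by positivity)]
    have hle : Real.sin s ^ 2 ≤ s := by
      nlinarith [Real.sin_le hs0.le]
    have hMs : |M| * s < 1 := by
      rw [hs, ← div_eq_mul_inv, div_lt_one (by positivity)]
      linarith
    nlinarith [le_abs_self M, abs_nonneg M, sq_nonneg (Real.sin s)]
  refine hterm.trans_le (Finset.single_le_sum (f := fun k =>
    2 * (halfRoot k !₂[0, 1] * halfRoot k !₂[0, 1]) / Real.sin (halfRoot k v) ^ 2)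
    (fun k _ => ?_) (Finset.mem_univ 1))
  exact div_nonneg (mul_nonneg two_pos.le (mul_self_nonneg _)) (sq_nonneg _)
end
end
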